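/- No non-abelian group of order 64 has the property that its Chermak-Delgado measure takes exactly two distinct values on its subgroups. -/

import Mathlib

/-- The Chermak–Delgado measure of a subgroup `H` of `G`: `|H| * |C_G(H)|`. -/
noncomputable def cdMeasure {G : Type*} [Group G] (H : Subgroup G) : ℕ :=
  Nat.card H * Nat.card (Subgroup.centralizer (H : Set G))

/-- `G` belongs to the class `C`: its Chermak–Delgado measure takes exactly two
distinct values on the subgroups of `G`. -/
def hasTwoCDValues (G : Type*) [Group G] : Prop :=
  (Set.range fun H : Subgroup G => cdMeasure H).ncard = 2

open scoped commutatorElement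

/-- If all commutators `⁅g, x⁆` lie in the central subgroup `B`, then `g ↦ ⁅g, x⁆` is a
homomorphism to `B`. -/
def commutatorHom {G : Type*} [Group G] (B : Subgroup G) (hB : B ≤ Subgroup.center G) (x : G)
    (hx : ∀ g : G, ⁅g, x⁆ ∈ B) : G →* B where
  toFun g := ⟨⁅g, x⁆, hx g⟩
  map_one' := by ext; simp
  map_mul' g h := by
    ext
    have hc := Subgroup.mem_center_iff.1 (hB (hx h)) g
    calc ⁅g * h, x⁆ = g * ⁅h, x⁆ * (x * g⁻¹ * x⁻¹) := by simp only [commutatorElement_def]; group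
      _ = ⁅h, x⁆ * ⁅g, x⁆ := by rw [hc]; simp only [commutatorElement_def]; group
      _ = ⁅g, x⁆ * ⁅h, x⁆ := (Subgroup.mem_center_iff.1 (hB (hx h)) _).symm

theorem ker_commutatorHom {G : Type*} [Group G] (B : Subgroup G) (hB : B ≤ Subgroup.center G)
    (x : G) (hx : ∀ g : G, ⁅g, x⁆ ∈ B) :
    (commutatorHom B hB x hx).ker = Subgroup.centralizer {x} := by
  ext g
  rw [MonoidHom.mem_ker, Subgroup.mem_centralizer_singleton_iff, Subtype.ext_iff]
  exact commutatorElement_eq_one_iff_mul_comm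

theorem commutatorHom_mul_right {G : Type*} [Group G] (B : Subgroup G)
    (hB : B ≤ Subgroup.center G) (h : ∀ x g : G, ⁅g, x⁆ ∈ B) (x y g : G) :
    commutatorHom B hB (x * y) (h _) g =
      commutatorHom B hB x (h _) g * commutatorHom B hB y (h _) g := by
  ext
  have hc := Subgroup.mem_center_iff.1 (hB (h y g)) x
  calc ⁅g, x * y⁆ = ⁅g, x⁆ * (x * ⁅g, y⁆) * x⁻¹ := by simp only [commutatorElement_def]; group
    _ = ⁅g, x⁆ * ⁅g, y⁆ := by rw [hc]; group

theorem Subgroup.two_mul_card_le_of_lt {G : Type*} [Group G] [Finite G] {H K : Subgroup G}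
    (h : H < K) : 2 * Nat.card H ≤ Nat.card K := by
  obtain ⟨k, hk⟩ := Subgroup.card_dvd_of_le h.le
  have hne : Nat.card H ≠ Nat.card K := fun he =>
    h.ne (Subgroup.eq_of_le_of_card_ge h.le he.ge)
  have hK : 0 < Nat.card K := Nat.card_pos
  have h2 : 2 ≤ k := by
    rcases k with _ | _ | k <;> omega
  calc 2 * Nat.card H ≤ k * Nat.card H := Nat.mul_le_mul_right _ h2
    _ = Nat.card K := by rw [hk, mul_comm]

/-- A group of order `32` has no central subgroup `B` of order `4` such that all elements outside
`B` have a centralizer of order `8`: a nonzero linear functional on `B` would turn the commutator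
map into a nondegenerate alternating form on a three-dimensional space. -/
theorem exists_card_centralizer_ne_of_card_thirtytwo {M : Type*} [Group M] [Finite M]
    (hM : Nat.card M = 32) (B : Subgroup M) (hB : B ≤ Subgroup.center M) (hB4 : Nat.card B = 4) :
    ∃ y ∉ B, Nat.card (Subgroup.centralizer {y}) ≠ 8 := by
  by_contra! hC
  have hBC : ∀ y : M, B ≤ Subgroup.centralizer {y} := fun y =>
    hB.trans (Subgroup.center_le_centralizer _)
  have hyC : ∀ y : M, y ∈ Subgroup.centralizer {y} := fun y =>
    Subgroup.mem_centralizer_singleton_iff.2 rfl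
  have hBn : B.Normal := ⟨fun b hb g => by
    rw [Subgroup.mem_center_iff.1 (hB hb) g, mul_inv_cancel_right]; exact hb⟩
  have hsq : ∀ y : M, y * y ∈ B := by
    intro y
    by_cases hy : y ∈ B
    · exact B.mul_mem hy hy
    have hi : (B.subgroupOf (Subgroup.centralizer {y})).index = 2 := by
      have h1 := Subgroup.card_mul_index (B.subgroupOf (Subgroup.centralizer {y}))
      rw [Nat.card_congr (Subgroup.subgroupOfEquivOfLe (hBC y)).toEquiv, hB4, hC y hy] at h1
      omega
    exact Subgroup.mul_self_mem_of_index_two hi ⟨y, hyC y⟩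
  have hcomm : ∀ x g : M, ⁅g, x⁆ ∈ B := by
    intro x g
    have h1 : ⁅g, x⁆ = (g * x) * (g * x) * (x⁻¹ * ((g⁻¹ * g⁻¹) * (x⁻¹ * x⁻¹)) * x⁻¹⁻¹) := by
      simp only [commutatorElement_def]; group
    rw [h1]
    exact B.mul_mem (hsq _) (hBn.conj_mem _ (B.mul_mem (hsq _) (hsq _)) _)
  have hsurj : ∀ y ∉ B, Function.Surjective (commutatorHom B hB y (hcomm y)) := by
    intro y hy
    rw [← MonoidHom.range_eq_top]
    apply Subgroup.eq_top_of_card_eq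
    have h1 := Subgroup.card_mul_index (commutatorHom B hB y (hcomm y)).ker
    rw [Subgroup.index_ker, ker_commutatorHom, hC y hy] at h1
    omega
  obtain ⟨N, hN⟩ := Sylow.exists_subgroup_card_pow_prime (G := B) 2 (n := 1) (by rw [hB4]; decide)
  have hNi : N.index = 2 := by
    have h1 := N.card_mul_index
    rw [hN, hB4] at h1
    omega
  have hNn : N.Normal := Subgroup.normal_of_index_eq_two hNi
  have hQ : Nat.card (B ⧸ N) = 2 := hNi
  let φ : M → M →* B ⧸ N := fun y => (QuotientGroup.mk' N).comp (commutatorHom B hB y (hcomm y))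
  have hφ : ∀ y ∉ B, Nat.card (φ y).ker = 16 := by
    intro y hy
    have h1 := Subgroup.card_mul_index (φ y).ker
    have h2 : (φ y).range = ⊤ :=
      MonoidHom.range_eq_top.2 ((QuotientGroup.mk'_surjective N).comp (hsurj y hy))
    rw [Subgroup.index_ker, h2, Subgroup.card_top, hQ] at h1
    omega
  have hBφ : ∀ y, ∀ b ∈ Subgroup.centralizer {y}, b ∈ (φ y).ker := by
    intro y b hb
    rw [← ker_commutatorHom B hB y (hcomm y), MonoidHom.mem_ker] at hb
    rw [MonoidHom.mem_ker]
    simp [φ, hb]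
  have hsymm : ∀ y w, w ∈ (φ y).ker → y ∈ (φ w).ker := by
    intro y w h
    have h1 : commutatorHom B hB w (hcomm w) y = (commutatorHom B hB y (hcomm y) w)⁻¹ := by
      ext
      exact (commutatorElement_inv w y).symm
    rw [MonoidHom.mem_ker] at h ⊢
    simp only [φ, MonoidHom.comp_apply] at h ⊢
    rw [h1, map_inv, h, inv_one]
  obtain ⟨y, hy⟩ : ∃ y, y ∉ B := by
    by_contra! h
    rw [(Subgroup.eq_top_iff' B).2 h, Subgroup.card_top] at hB4
    omega
  obtain ⟨w, hw, hwA⟩ : ∃ w ∈ (φ y).ker, w ∉ Subgroup.centralizer {y} := by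
    by_contra! h
    have h1 := Subgroup.card_le_of_le (show (φ y).ker ≤ _ from h)
    rw [hφ y hy, hC y hy] at h1
    omega
  have hwB : w ∉ B := fun h => hwA (hBC y h)
  set L := (φ y).ker ⊓ (φ w).ker
  have hyL : y ∈ L := ⟨hBφ y y (hyC y), hsymm y w hw⟩
  have hAL : Subgroup.centralizer {y} ≤ L := by
    have h1 : B < L ⊓ Subgroup.centralizer {y} := by
      refine lt_of_le_of_ne (fun b hb => ⟨⟨hBφ _ _ (hBC _ hb), hBφ _ _ (hBC _ hb)⟩, hBC _ hb⟩) ?_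
      intro h
      exact hy (h ▸ (⟨hyL, hyC y⟩ : y ∈ L ⊓ Subgroup.centralizer {y}))
    have h2 := Subgroup.two_mul_card_le_of_lt h1
    have h3 : L ⊓ Subgroup.centralizer {y} = Subgroup.centralizer {y} :=
      Subgroup.eq_of_le_of_card_ge inf_le_right (by rw [hC y hy]; omega)
    exact h3 ▸ inf_le_left
  have hL16 : 16 ≤ Nat.card L := by
    have h1 : Subgroup.centralizer {y} < L :=
      lt_of_le_of_ne hAL fun h => hwA (h ▸ (⟨hw, hBφ w w (hyC w)⟩ : w ∈ L))
    have h2 := Subgroup.two_mul_card_le_of_lt h1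
    rw [hC y hy] at h2
    omega
  have hker : (φ y).ker = (φ w).ker :=
    (Subgroup.eq_of_le_of_card_ge (inf_le_left : L ≤ _) (by rw [hφ y hy]; exact hL16)).symm.trans
      (Subgroup.eq_of_le_of_card_ge (inf_le_right : L ≤ _) (by rw [hφ w hwB]; exact hL16))
  have hyw : y * w ∉ B := by
    intro h
    refine hwA ?_
    have h1 := (Subgroup.centralizer {y}).mul_mem (inv_mem (hyC y)) (hBC y h)
    rwa [inv_mul_cancel_left] at h1
  have htop : (φ (y * w)).ker = ⊤ := by
    rw [Subgroup.eq_top_iff']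
    intro g
    have hmul : φ (y * w) g = φ y g * φ w g := by
      simp only [φ, MonoidHom.comp_apply, commutatorHom_mul_right B hB hcomm, map_mul]
    rw [MonoidHom.mem_ker, hmul]
    by_cases hg : g ∈ (φ y).ker
    · have hg' := hg
      rw [hker] at hg'
      rw [MonoidHom.mem_ker.1 hg, MonoidHom.mem_ker.1 hg', one_mul]
    · have hg' := hg
      rw [hker] at hg'
      rw [MonoidHom.mem_ker] at hg hg'
      obtain ⟨a, b, -, hab⟩ := Nat.card_eq_two_iff.1 hQ
      have hmem : ∀ q : B ⧸ N, q = a ∨ q = b := fun q => by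
        have : q ∈ ({a, b} : Set (B ⧸ N)) := hab ▸ Set.mem_univ q
        simpa using this
      have heq : φ y g = φ w g := by
        rcases hmem (φ y g) with h1 | h1 <;> rcases hmem (φ w g) with h2 | h2 <;>
          rcases hmem 1 with h3 | h3 <;> simp_all
      have hpow := pow_card_eq_one' (x := φ w g)
      rw [hQ, pow_two] at hpow
      rw [heq, hpow]
  have := hφ _ hyw
  rw [htop, Subgroup.card_top] at this
  omega

/-- Adjoining a centralizing element to a commutative subgroup keeps it commutative. -/
theorem Subgroup.sup_zpowers_le_centralizer {G : Type*} [Group G] {A : Subgroup G}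
    (hA : A ≤ Subgroup.centralizer (A : Set G)) {b : G}
    (hb : b ∈ Subgroup.centralizer (A : Set G)) :
    A ⊔ Subgroup.zpowers b ≤
      Subgroup.centralizer ((A ⊔ Subgroup.zpowers b : Subgroup G) : Set G) := by
  have hbA : Subgroup.zpowers b ≤ Subgroup.centralizer (A : Set G) := by simpa using hb
  have hbb : Subgroup.zpowers b ≤ Subgroup.centralizer (Subgroup.zpowers b : Set G) :=
    Subgroup.le_centralizer _
  refine sup_le ?_ ?_ <;> rw [Subgroup.le_centralizer_iff]
  · exact sup_le hA hbA
  · exact sup_le (Subgroup.le_centralizer_iff.1 hbA) hbb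

theorem not_hasTwoCDValues_of_card_sixtyfour (G : Type*) [Group G] [Finite G]
    (hcard : Nat.card G = 64) (hnab : ¬ ∀ a b : G, a * b = b * a) :
    ¬ hasTwoCDValues G := by
  intro htwo
  have : Fact (Nat.Prime 2) := ⟨Nat.prime_two⟩
  have hp : IsPGroup 2 G := IsPGroup.of_card (n := 6) (by rw [hcard]; norm_num)
  have : Nontrivial G := Finite.one_lt_card_iff_nontrivial.1 (by omega)
  have hZne : Subgroup.center G ≠ ⊤ := fun h =>
    hnab fun a b => (Subgroup.mem_center_iff.1 (h ▸ Subgroup.mem_top b : b ∈ Subgroup.center G) a)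
  have hcentral : ∀ K : Subgroup G, K ≤ Subgroup.center G → cdMeasure K = Nat.card K * 64 := by
    intro K hK
    rw [cdMeasure, Subgroup.centralizer_eq_top_iff_subset.2 hK, Subgroup.card_top, hcard]
  have hbot : cdMeasure (⊥ : Subgroup G) = 64 := by
    rw [hcentral _ bot_le, Subgroup.card_bot, one_mul]
  have hval : ∀ H K : Subgroup G, cdMeasure K ≠ 64 →
      cdMeasure H = 64 ∨ cdMeasure H = cdMeasure K := by
    obtain ⟨a, b, -, hab⟩ := Set.ncard_eq_two.1 htwo
    have hmem : ∀ H : Subgroup G, cdMeasure H = a ∨ cdMeasure H = b := fun H => by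
      have : cdMeasure H ∈ ({a, b} : Set ℕ) := hab ▸ Set.mem_range_self H
      simpa using this
    intro H K hK
    have h1 := hmem H
    have h2 := hmem K
    have h3 := hmem ⊥
    omega
  have hZnt : Nontrivial (Subgroup.center G) := hp.center_nontrivial
  obtain ⟨t, ht⟩ := exists_prime_orderOf_dvd_card' (G := Subgroup.center G) 2 (by
    have h1 := (IsPGroup.iff_card.1 (hp.to_subgroup (Subgroup.center G)))
    obtain ⟨n, hn⟩ := h1
    have h2 := Finite.one_lt_card_iff_nontrivial.2 hZnt
    rcases n with _ | n
    · omega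
    · rw [hn, pow_succ]; exact dvd_mul_left _ _)
  have hTm : cdMeasure (Subgroup.zpowers (t : G)) = 128 := by
    rw [hcentral _ (by simp), Nat.card_zpowers, Subgroup.orderOf_coe, ht]
  have hm : ∀ H : Subgroup G, cdMeasure H = 64 ∨ cdMeasure H = 128 := fun H => by
    have := hval H (Subgroup.zpowers (t : G)) (by omega)
    omega
  have hZ2 : Nat.card (Subgroup.center G) = 2 := by
    have h1 := hm (Subgroup.center G)
    have h2 := Finite.one_lt_card_iff_nontrivial.2 hZnt
    rw [hcentral _ le_rfl] at h1
    omega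
  have habel : ∀ A : Subgroup G, A ≤ Subgroup.centralizer (A : Set G) → Nat.card A < 16 := by
    intro A hA
    have h1 := hm A
    have h2 := Subgroup.card_le_of_le hA
    rw [cdMeasure] at h1
    by_contra! h3
    have := Nat.mul_le_mul h3 (h3.trans h2)
    omega
  have hself : ∀ A : Subgroup G, A ≤ Subgroup.centralizer (A : Set G) → 8 ≤ Nat.card A →
      Nat.card (Subgroup.centralizer (A : Set G)) = 8 := by
    intro A hA h8
    have h1 : Subgroup.centralizer (A : Set G) = A := by
      refine le_antisymm (fun b hb => ?_) hA
      by_contra hbA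
      have h2 : A < A ⊔ Subgroup.zpowers b := left_lt_sup.2 (by simpa using hbA)
      have h3 := Subgroup.two_mul_card_le_of_lt h2
      have h4 := habel _ (Subgroup.sup_zpowers_le_centralizer hA hb)
      omega
    have h2 := habel A hA
    have h3 : Nat.card A ∣ 64 := hcard ▸ A.card_subgroup_dvd_card
    rw [h1]
    interval_cases Nat.card A <;> omega
  obtain ⟨x, hxZ, hx⟩ : ∃ x : G, x ∉ Subgroup.center G ∧ ∀ g : G, ⁅g, x⁆ ∈ Subgroup.center G := by
    have hnt : Nontrivial (G ⧸ Subgroup.center G) := QuotientGroup.nontrivial_iff.2 hZne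
    have hcnt : Nontrivial (Subgroup.center (G ⧸ Subgroup.center G)) :=
      (hp.to_quotient (Subgroup.center G)).center_nontrivial
    obtain ⟨⟨q, hq⟩, hq1⟩ := exists_ne (1 : Subgroup.center (G ⧸ Subgroup.center G))
    obtain ⟨x, rfl⟩ := QuotientGroup.mk_surjective q
    refine ⟨x, fun h => hq1 (Subtype.ext ((QuotientGroup.eq_one_iff x).2 h)), fun g => ?_⟩
    rw [← QuotientGroup.eq_one_iff]
    exact commutatorElement_eq_one_iff_mul_comm.2 (Subgroup.mem_center_iff.1 hq g)
  set M := Subgroup.centralizer {x} with hMdef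
  have hM32 : Nat.card M = 32 := by
    have h1 := Subgroup.card_mul_index (commutatorHom _ le_rfl x hx).ker
    rw [Subgroup.index_ker, ker_commutatorHom, hcard] at h1
    have h2 := Subgroup.card_le_card_group (commutatorHom _ le_rfl x hx).range
    rw [hZ2] at h2
    have h3 : Nat.card M ≠ 64 := by
      intro h
      have h4 : M = ⊤ := Subgroup.eq_top_of_card_eq _ (by rw [h, hcard])
      refine hxZ (Subgroup.mem_center_iff.2 fun g => ?_)
      exact Subgroup.mem_centralizer_singleton_iff.1 (h4 ▸ Subgroup.mem_top g : g ∈ M)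
    rw [← hMdef] at h1
    interval_cases Nat.card (commutatorHom _ le_rfl x hx).range <;> omega
  set B := Subgroup.center G ⊔ Subgroup.zpowers x
  have hBM : B ≤ M := sup_le (Subgroup.center_le_centralizer _)
    (by simpa using Subgroup.mem_centralizer_singleton_iff.2 rfl)
  have hMB : M ≤ Subgroup.centralizer (B : Set G) := by
    rw [Subgroup.le_centralizer_iff]
    refine sup_le (Subgroup.center_le_centralizer _) ?_
    rw [Subgroup.zpowers_le]
    intro g hg
    exact Subgroup.mem_centralizer_singleton_iff.1 hg
  have hBB : B ≤ Subgroup.centralizer (B : Set G) := hBM.trans hMB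
  have hB4 : Nat.card B = 4 := by
    have h1 : Subgroup.center G < B := left_lt_sup.2 (by simpa using hxZ)
    have h2 := Subgroup.two_mul_card_le_of_lt h1
    have h3 := hm M
    have h4 := Subgroup.card_le_of_le (Subgroup.le_centralizer_iff.1 hMB)
    rw [cdMeasure, hM32] at h3
    omega
  obtain ⟨y, hy, hy8⟩ := exists_card_centralizer_ne_of_card_thirtytwo hM32 (B.subgroupOf M)
    (fun b hb => Subgroup.mem_center_iff.2 fun g => Subtype.ext (hMB g.2 _ hb).symm)
    (by rw [Nat.card_congr (Subgroup.subgroupOfEquivOfLe hBM).toEquiv, hB4])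
  have hyB : (y : G) ∉ B := hy
  refine hy8 ?_
  have hA : 8 ≤ Nat.card (B ⊔ Subgroup.zpowers (y : G) : Subgroup G) := by
    have h1 : B < B ⊔ Subgroup.zpowers (y : G) := left_lt_sup.2 (by simpa using hyB)
    have h2 := Subgroup.two_mul_card_le_of_lt h1
    omega
  rw [← hself _ (Subgroup.sup_zpowers_le_centralizer hBB (hMB y.2)) hA,
    ← Subgroup.card_map_of_injective M.subtype_injective]
  congr 2
  ext g
  constructor
  · rintro ⟨g, hg, rfl⟩
    have h1 : B ⊔ Subgroup.zpowers (y : G) ≤ Subgroup.centralizer {(g : G)} := by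
      refine sup_le (fun b hb => ?_) ?_
      · exact Subgroup.mem_centralizer_singleton_iff.2 (hMB g.2 b hb)
      · rw [Subgroup.zpowers_le]
        exact Subgroup.mem_centralizer_singleton_iff.2
          (congrArg Subtype.val (Subgroup.mem_centralizer_singleton_iff.1 hg)).symm
    exact fun d hd => Subgroup.mem_centralizer_singleton_iff.1 (h1 hd)
  · intro hg
    have hgx : g ∈ M := Subgroup.mem_centralizer_singleton_iff.2
      (hg x ((le_sup_right.trans le_sup_left : Subgroup.zpowers x ≤ _)
        (Subgroup.mem_zpowers x))).symm
    exact ⟨⟨g, hgx⟩, Subgroup.mem_centralizer_singleton_iff.2 (Subtype.ext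
      (hg y ((le_sup_right : Subgroup.zpowers (y : G) ≤ _) (Subgroup.mem_zpowers _))).symm), rfl⟩
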